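/- Changes of routing: for all square-summable f, g : Ẽ → ℝ, ⟨f, Q^Z g⟩_π̃ − ⟨f, Q^{Z′} g⟩_π̃ = Σ_{(D,n)∈Ẽ} π̃(D,n)·(λ/ξ^D_0)·Σ_{j∈J̃₀∖D} Σ_{i∈J̃₀∖D} ξ^D_j (r^D_{ji} − r′^D_{ji}) f(D,n+e_j) g(D,n+e_i); equivalently, the inner double sum equals the trace of W^{g,f}(D,n)·diag(ξ^D)·(R^D − R′^D), where W^{g,f}(D,n) is the matrix (g(D,n+e_i) f(D,n+e_j))_{i,j∈J̃₀∖D}. -/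

import Mathlib

open scoped BigOperators

noncomputable section

namespace UnrelNet

/-- State space of the unreliable Jackson network: a set of broken-down nodes
together with a queue-length vector. -/
abbrev Est (J : ℕ) := Finset (Fin J) × (Fin J → ℕ)

/-- The extended node set `J̃₀ ∖ D`: the exterior node `none` together with
the up nodes (complement of `D`). -/
def ext (J : ℕ) (D : Finset (Fin J)) : Finset (Option (Fin J)) :=
  insert none (Dᶜ.image Option.some)

/-- Unit vector `e_j` of `ℕ^J̃`, with `e_0 = 0` (index `none`). -/
def eV {J : ℕ} (o : Option (Fin J)) : Fin J → ℕ := fun i =>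
  match o with
  | none => 0
  | some j => if i = j then 1 else 0

/-- Breakdown/repair generator `Q^Y`. -/
def QY {J : ℕ} (A B : Finset (Fin J) → ℝ) (f : Finset (Fin J) → ℝ)
    (D : Finset (Fin J)) : ℝ :=
  (∑ H ∈ Finset.univ.filter (fun H => H ⊂ D), B D / B H * (f H - f D))
    + ∑ I ∈ Finset.univ.filter (fun I => D ⊂ I), A I / A D * (f I - f D)

/-- Off-diagonal breakdown/repair rates. -/
def qY0 {J : ℕ} (A B : Finset (Fin J) → ℝ) (D E : Finset (Fin J)) : ℝ :=
  if D ⊂ E then A E / A D else if E ⊂ D then B D / B E else 0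

/-- Breakdown/repair rate matrix `q^Y`, including the diagonal. -/
def qY {J : ℕ} (A B : Finset (Fin J) → ℝ) (D E : Finset (Fin J)) : ℝ :=
  if E = D then -∑ F, qY0 A B D F else qY0 A B D E

/-- Breakdown/repair generator written via the rate matrix. -/
def QYm {J : ℕ} (A B : Finset (Fin J) → ℝ) (f : Finset (Fin J) → ℝ)
    (D : Finset (Fin J)) : ℝ :=
  ∑ E, qY A B D E * f E

/-- Normalisation constant `Ĉ`. -/
def Chat {J : ℕ} (A B : Finset (Fin J) → ℝ) : ℝ := ∑ D, A D / B D

/-- Stationary distribution `π̂` of the breakdown/repair process. -/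
def piY {J : ℕ} (A B : Finset (Fin J) → ℝ) (D : Finset (Fin J)) : ℝ :=
  (A D / B D) / Chat A B

/-- `Π_{i=1}^{k} η_j/μ_j(i)`. -/
def prodK {J : ℕ} (η : Fin J → ℝ) (μ : Fin J → ℕ → ℝ) (j : Fin J) (k : ℕ) : ℝ :=
  ∏ i ∈ Finset.range k, η j / μ j (i + 1)

/-- Normalisation constant `C_j`. -/
def Cnorm {J : ℕ} (η : Fin J → ℝ) (μ : Fin J → ℕ → ℝ) (j : Fin J) : ℝ :=
  ∑' k : ℕ, prodK η μ j k

/-- Product-form stationary distribution `π` of the Jackson network. -/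
def piX {J : ℕ} (η : Fin J → ℝ) (μ : Fin J → ℕ → ℝ) (n : Fin J → ℕ) : ℝ :=
  ∏ j, prodK η μ j (n j) / Cnorm η μ j

/-- Product measure `π̃(D,n) = π̂(D)·π(n)`. -/
def piZ {J : ℕ} (η : Fin J → ℝ) (μ : Fin J → ℕ → ℝ) (A B : Finset (Fin J) → ℝ)
    (x : Est J) : ℝ :=
  piY A B x.1 * piX η μ x.2

/-- Generator `Q^Z` of the unreliable Jackson network. -/
def QZ {J : ℕ} (lam : ℝ) (μ : Fin J → ℕ → ℝ)
    (r : Finset (Fin J) → Option (Fin J) → Option (Fin J) → ℝ)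
    (A B : Finset (Fin J) → ℝ) (f : Est J → ℝ) (x : Est J) : ℝ :=
  (∑ j ∈ x.1ᶜ, lam * r x.1 none (some j) * (f (x.1, x.2 + eV (some j)) - f x))
    + (∑ j ∈ x.1ᶜ, μ j (x.2 j) * r x.1 (some j) none * (f (x.1, x.2 - eV (some j)) - f x))
    + (∑ j ∈ x.1ᶜ, ∑ i ∈ x.1ᶜ,
        μ j (x.2 j) * r x.1 (some j) (some i) * (f (x.1, x.2 - eV (some j) + eV (some i)) - f x))
    + (∑ H ∈ Finset.univ.filter (fun H => H ⊂ x.1), B x.1 / B H * (f (H, x.2) - f x))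
    + ∑ I ∈ Finset.univ.filter (fun I => x.1 ⊂ I), A I / A x.1 * (f (I, x.2) - f x)

/-- Transition-rate matrix `q^Z` of the unreliable Jackson network
(between distinct states; the diagonal is set to `0`). -/
def qZ {J : ℕ} (lam : ℝ) (μ : Fin J → ℕ → ℝ)
    (r : Finset (Fin J) → Option (Fin J) → Option (Fin J) → ℝ)
    (A B : Finset (Fin J) → ℝ) (x y : Est J) : ℝ :=
  if x = y then 0
  else
    (if y.1 = x.1 then
        ∑ j ∈ x.1ᶜ,
          ((if y.2 = x.2 + eV (some j) then lam * r x.1 none (some j) else 0)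
            + (if y.2 + eV (some j) = x.2 then μ j (x.2 j) * r x.1 (some j) none else 0)
            + ∑ i ∈ x.1ᶜ,
                if i ≠ j ∧ y.2 + eV (some j) = x.2 + eV (some i) then
                  μ j (x.2 j) * r x.1 (some j) (some i)
                else 0)
      else 0)
    + (if y.2 = x.2 then
        (if y.1 ⊂ x.1 then B x.1 / B y.1 else 0) + (if x.1 ⊂ y.1 then A y.1 / A x.1 else 0)
      else 0)

/-- Extension `η^D` of the traffic solution: `η^D_0 = λ`, `η^D_j = η_j`. -/
def etaE {J : ℕ} (lam : ℝ) (η : Fin J → ℝ) : Option (Fin J) → ℝ := fun o => o.elim lam η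

/-- Normalised routing-equilibrium vector `ξ^D`. -/
def xiV {J : ℕ} (lam : ℝ) (η : Fin J → ℝ) (D : Finset (Fin J))
    (o : Option (Fin J)) : ℝ :=
  etaE lam η o / ∑ k ∈ ext J D, etaE lam η k

/-- Spectral gap of a generator on the network state space w.r.t. a measure `m`. -/
def GapZ {J : ℕ} (m : Est J → ℝ) (Q : (Est J → ℝ) → Est J → ℝ) : ℝ :=
  sInf {v : ℝ | ∃ f : Est J → ℝ,
    Summable (fun x => f x * f x * m x) ∧ (∑' x, f x * m x) = 0 ∧
      (∑' x, f x * f x * m x) = 1 ∧ v = ∑' x, f x * -(Q f x) * m x}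

/-- Spectral gap of a generator on `2^{J̃}` w.r.t. a probability vector `m`. -/
def GapY {J : ℕ} (m : Finset (Fin J) → ℝ)
    (Q : (Finset (Fin J) → ℝ) → Finset (Fin J) → ℝ) : ℝ :=
  sInf {v : ℝ | ∃ f : Finset (Fin J) → ℝ,
    (∑ D, m D * f D) = 0 ∧ (∑ D, m D * f D ^ 2) = 1 ∧
      v = -(∑ D, m D * f D * Q f D)}

/-- Merge a vector indexed by `D` with a vector indexed by `J̃∖D`. -/
def merge {J : ℕ} (D : Finset (Fin J)) (a : {j : Fin J // j ∈ D} → ℕ)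
    (b : {j : Fin J // j ∉ D} → ℕ) : Fin J → ℕ := fun j =>
  if h : j ∈ D then a ⟨j, h⟩ else b ⟨j, h⟩

/-- Marginal product-form density on a sub-collection of nodes. -/
def piSub {J : ℕ} (η : Fin J → ℝ) (μ : Fin J → ℕ → ℝ) (p : Fin J → Prop)
    [DecidablePred p] (a : {j : Fin J // p j} → ℕ) : ℝ :=
  ∏ j : {j : Fin J // p j}, prodK η μ j.1 (a j) / Cnorm η μ j.1

/-- Unit vector on a subtype index set. -/
def eS {J : ℕ} {p : Fin J → Prop} (j : {k : Fin J // p k}) :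
    {k : Fin J // p k} → ℕ := fun i => if i = j then 1 else 0

/-- Generator of the synthetic subnetwork on the up nodes `J̃∖D`. -/
def QXsub {J : ℕ} (lam : ℝ) (μ : Fin J → ℕ → ℝ)
    (r : Finset (Fin J) → Option (Fin J) → Option (Fin J) → ℝ)
    (D : Finset (Fin J)) (h : ({j : Fin J // j ∉ D} → ℕ) → ℝ)
    (m : {j : Fin J // j ∉ D} → ℕ) : ℝ :=
  (∑ j : {j : Fin J // j ∉ D}, lam * r D none (some j.1) * (h (m + eS j) - h m))
    + (∑ j : {j : Fin J // j ∉ D}, μ j.1 (m j) * r D (some j.1) none * (h (m - eS j) - h m))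
    + ∑ j : {j : Fin J // j ∉ D}, ∑ i : {j : Fin J // j ∉ D},
        μ j.1 (m j) * r D (some j.1) (some i.1) * (h (m - eS j + eS i) - h m)

/-- Transition-rate matrix `q^X` of the (reliable) Jackson network. -/
def qX {J : ℕ} (lam : ℝ) (μ : Fin J → ℕ → ℝ)
    (r : Option (Fin J) → Option (Fin J) → ℝ) (n m : Fin J → ℕ) : ℝ :=
  if n = m then 0
  else
    ∑ j : Fin J,
      ((if m = n + eV (some j) then lam * r none (some j) else 0)
        + (if m + eV (some j) = n then μ j (n j) * r (some j) none else 0)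
        + ∑ i : Fin J,
            if i ≠ j ∧ m + eV (some j) = n + eV (some i) then
              μ j (n j) * r (some j) (some i)
            else 0)

/-- One-step Markov operator `K = Id + ε·Q`. -/
def Kop {J : ℕ} (ε : ℝ) (Q : (Est J → ℝ) → Est J → ℝ) :
    (Est J → ℝ) → Est J → ℝ := fun h x => h x + ε * Q h x

/-- rate -/
def rt {J : ℕ} (lam : ℝ) (μ : Fin J → ℕ → ℝ) (o : Option (Fin J)) (n : Fin J → ℕ) : ℝ :=
  match o with
  | none => lam
  | some j => μ j (n j)

/-- extended-by-zero routing -/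
def cR {J : ℕ} (r : Finset (Fin J) → Option (Fin J) → Option (Fin J) → ℝ)
    (D : Finset (Fin J)) (j i : Option (Fin J)) : ℝ :=
  if j ∈ ext J D then (if i ∈ ext J D then r D j i else 0) else 0

/-- shift -/
def sh {J : ℕ} (o : Option (Fin J)) (x : Est J) : Est J := (x.1, x.2 + eV o)

lemma sh_inj {J : ℕ} (o : Option (Fin J)) : Function.Injective (sh o) := by
  rintro ⟨D, n⟩ ⟨D', n'⟩ h
  simp only [sh, Prod.mk.injEq, add_left_inj] at h
  exact Prod.ext h.1 h.2

lemma eV_none {J : ℕ} : (eV none : Fin J → ℕ) = 0 := rfl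

lemma piX_shift {J : ℕ} (η : Fin J → ℝ) (μ : Fin J → ℕ → ℝ)
    (hμpos : ∀ j k, k ≠ 0 → 0 < μ j k) (n : Fin J → ℕ) (j : Fin J) :
    μ j (n j + 1) * piX η μ (n + eV (some j)) = η j * piX η μ n := by
  unfold piX
  rw [← Finset.mul_prod_erase Finset.univ _ (Finset.mem_univ j),
    ← Finset.mul_prod_erase Finset.univ (fun j => prodK η μ j (n j) / Cnorm η μ j)
      (Finset.mem_univ j)]
  have h1 : ∏ x ∈ Finset.univ.erase j, prodK η μ x ((n + eV (some j)) x) / Cnorm η μ x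
      = ∏ x ∈ Finset.univ.erase j, prodK η μ x (n x) / Cnorm η μ x := by
    refine Finset.prod_congr rfl fun x hx => ?_
    have : x ≠ j := (Finset.mem_erase.mp hx).1
    simp [eV, this]
  rw [h1]
  have h2 : (n + eV (some j)) j = n j + 1 := by simp [eV]
  rw [h2]
  have h3 : μ j (n j + 1) ≠ 0 := (hμpos j _ (Nat.succ_ne_zero _)).ne'
  have h4 : prodK η μ j (n j + 1) = prodK η μ j (n j) * (η j / μ j (n j + 1)) := by
    unfold prodK; rw [Finset.prod_range_succ]
  rw [h4]
  field_simp

lemma piZ_shift {J : ℕ} (lam : ℝ) (η : Fin J → ℝ) (μ : Fin J → ℕ → ℝ)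
    (hμpos : ∀ j k, k ≠ 0 → 0 < μ j k) (A B : Finset (Fin J) → ℝ)
    (o : Option (Fin J)) (x : Est J) :
    rt lam μ o (x.2 + eV o) * piZ η μ A B (sh o x) = etaE lam η o * piZ η μ A B x := by
  cases o with
  | none => simp [rt, etaE, sh, eV_none]
  | some j =>
    have := piX_shift η μ hμpos x.2 j
    simp only [rt, etaE, sh, piZ, Option.elim]
    have h2 : (x.2 + eV (some j)) j = x.2 j + 1 := by simp [eV]
    rw [h2]
    linear_combination piY A B x.1 * this

lemma rt_zero {J : ℕ} (lam : ℝ) (μ : Fin J → ℕ → ℝ) (hμ0 : ∀ j, μ j 0 = 0)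
    (o : Option (Fin J)) (x : Est J) (hx : x ∉ Set.range (sh o)) : rt lam μ o x.2 = 0 := by
  cases o with
  | none => exact absurd ⟨x, by simp [sh, eV_none]⟩ hx
  | some j =>
    by_cases h : x.2 j = 0
    · simp [rt, h, hμ0]
    · refine absurd ⟨(x.1, x.2 - eV (some j)), ?_⟩ hx
      refine Prod.ext rfl ?_
      funext k
      by_cases hk : k = j
      · subst hk; simp [sh, eV]; omega
      · simp [sh, eV, hk]

lemma summ_bdd {α : Type*} {F c : α → ℝ} (hF : Summable F) (K : ℝ) (hc : ∀ x, |c x| ≤ K) :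
    Summable fun x => c x * F x := by
  refine Summable.of_norm_bounded (g := fun x => K * ‖F x‖) (hF.norm.mul_left K) fun x => ?_
  rw [norm_mul]
  exact mul_le_mul_of_nonneg_right (hc x) (norm_nonneg _)

lemma summ_fin {J : ℕ} {F : Est J → ℝ} (c : Finset (Fin J) → ℝ) (hF : Summable F) :
    Summable fun x => c x.1 * F x := by
  refine summ_bdd hF (∑ D, |c D|) fun x => ?_
  exact Finset.single_le_sum (f := fun D => |c D|) (fun _ _ => abs_nonneg _) (Finset.mem_univ x.1)

lemma summ_cs {α : Type*} {u v p : α → ℝ} (hp : ∀ x, 0 ≤ p x)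
    (hu : Summable fun x => u x * u x * p x) (hv : Summable fun x => v x * v x * p x) :
    Summable fun x => u x * v x * p x := by
  refine Summable.of_norm_bounded (hu.add hv) fun x => ?_
  rw [Real.norm_eq_abs, abs_mul, abs_of_nonneg (hp x), abs_mul, ← add_mul]
  refine mul_le_mul_of_nonneg_right ?_ (hp x)
  have h1 := abs_mul_abs_self (u x)
  have h2 := abs_mul_abs_self (v x)
  nlinarith [sq_nonneg (|u x| - |v x|), sq_nonneg (|u x|), sq_nonneg (|v x|)]

lemma Chat_pos {J : ℕ} (A B : Finset (Fin J) → ℝ)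
    (hApos : ∀ D, 0 < A D) (hBpos : ∀ D, 0 < B D) : 0 < Chat A B :=
  Finset.sum_pos (fun D _ => div_pos (hApos D) (hBpos D)) ⟨∅, Finset.mem_univ _⟩

lemma piY_pos {J : ℕ} (A B : Finset (Fin J) → ℝ)
    (hApos : ∀ D, 0 < A D) (hBpos : ∀ D, 0 < B D) (D) : 0 < piY A B D :=
  div_pos (div_pos (hApos D) (hBpos D)) (Chat_pos A B hApos hBpos)

lemma piX_nn {J : ℕ} (η : Fin J → ℝ) (hη : ∀ j, 0 < η j) (μ : Fin J → ℕ → ℝ)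
    (hμpos : ∀ j k, k ≠ 0 → 0 < μ j k) (n : Fin J → ℕ) : 0 ≤ piX η μ n := by
  have h : ∀ j k, 0 ≤ prodK η μ j k := fun j k =>
    Finset.prod_nonneg fun i _ => (div_pos (hη j) (hμpos j _ (Nat.succ_ne_zero _))).le
  exact Finset.prod_nonneg fun j _ => div_nonneg (h _ _) (tsum_nonneg fun k => h _ _)

lemma piZ_nn {J : ℕ} (η : Fin J → ℝ) (hη : ∀ j, 0 < η j) (μ : Fin J → ℕ → ℝ)
    (hμpos : ∀ j k, k ≠ 0 → 0 < μ j k) (A B : Finset (Fin J) → ℝ)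
    (hApos : ∀ D, 0 < A D) (hBpos : ∀ D, 0 < B D) (x : Est J) : 0 ≤ piZ η μ A B x :=
  mul_nonneg (piY_pos A B hApos hBpos _).le (piX_nn η hη μ hμpos _)

lemma etaE_pos {J : ℕ} (lam : ℝ) (hlam : 0 < lam) (η : Fin J → ℝ) (hη : ∀ j, 0 < η j)
    (o : Option (Fin J)) : 0 < etaE lam η o := by
  cases o with
  | none => exact hlam
  | some j => exact hη j

lemma rt_bdd {J : ℕ} (lam : ℝ) (hlam : 0 < lam) (μ : Fin J → ℕ → ℝ) (hμ0 : ∀ j, μ j 0 = 0)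
    (hμpos : ∀ j k, k ≠ 0 → 0 < μ j k) (hμbdd : ∃ M : ℝ, ∀ j k, μ j k ≤ M) :
    ∃ K : ℝ, ∀ o n, |rt lam μ o n| ≤ K := by
  obtain ⟨M, hM⟩ := hμbdd
  refine ⟨max lam M, fun o n => ?_⟩
  cases o with
  | none => simp [rt, abs_of_pos hlam]
  | some j =>
    have : 0 ≤ μ j (n j) := by
      by_cases h : n j = 0
      · rw [h, hμ0]
      · exact (hμpos j _ h).le
    simp only [rt]
    rw [abs_of_nonneg this]
    exact (hM _ _).trans (le_max_right _ _)

lemma summ_shift {J : ℕ} (lam : ℝ) (hlam : 0 < lam) (μ : Fin J → ℕ → ℝ) (hμ0 : ∀ j, μ j 0 = 0)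
    (hμpos : ∀ j k, k ≠ 0 → 0 < μ j k) (hμbdd : ∃ M : ℝ, ∀ j k, μ j k ≤ M)
    (η : Fin J → ℝ) (hη : ∀ j, 0 < η j) (A B : Finset (Fin J) → ℝ) (h : Est J → ℝ)
    (hh : Summable (fun x : Est J => h x * h x * piZ η μ A B x)) (o : Option (Fin J)) :
    Summable (fun x : Est J => h (sh o x) * h (sh o x) * piZ η μ A B x) := by
  obtain ⟨K, hK⟩ := rt_bdd lam hlam μ hμ0 hμpos hμbdd
  have h1 := summ_bdd (c := fun x : Est J => rt lam μ o (x.2 + eV o)) (hh.comp_injective (sh_inj o)) K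
    (fun x => hK _ _)
  refine (h1.mul_left (etaE lam η o)⁻¹).congr fun x => ?_
  have h2 := piZ_shift lam η μ hμpos A B o x
  have h3 := (etaE_pos lam hlam η hη o).ne'
  simp only [Function.comp]
  field_simp
  linear_combination h (sh o x) ^ 2 * h2

/-- summand after reindexing -/
def Uu {J : ℕ} (lam : ℝ) (η : Fin J → ℝ) (μ : Fin J → ℕ → ℝ) (A B : Finset (Fin J) → ℝ)
    (f g : Est J → ℝ) (j i : Option (Fin J)) (x : Est J) : ℝ :=
  etaE lam η j * (f (sh j x) * g (sh i x) * piZ η μ A B x)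

/-- summand before reindexing -/
def Tt {J : ℕ} (lam : ℝ) (η : Fin J → ℝ) (μ : Fin J → ℕ → ℝ) (A B : Finset (Fin J) → ℝ)
    (f g : Est J → ℝ) (j i : Option (Fin J)) (x : Est J) : ℝ :=
  rt lam μ j x.2 * (f x * g (x.1, x.2 - eV j + eV i) * piZ η μ A B x)

lemma T_sh {J : ℕ} (lam : ℝ) (η : Fin J → ℝ) (μ : Fin J → ℕ → ℝ)
    (hμpos : ∀ j k, k ≠ 0 → 0 < μ j k) (A B : Finset (Fin J) → ℝ)
    (f g : Est J → ℝ) (j i : Option (Fin J)) (x : Est J) :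
    Tt lam η μ A B f g j i (sh j x) = Uu lam η μ A B f g j i x := by
  unfold Tt Uu
  have h2 := piZ_shift lam η μ hμpos A B j x
  have h3 : (((sh j x).1, (sh j x).2 - eV j + eV i) : Est J) = sh i x := by
    simp [sh]
  rw [h3]
  have h4 : (sh j x).2 = x.2 + eV j := rfl
  rw [h4]
  linear_combination f (sh j x) * g (sh i x) * h2

lemma QZ_decomp {J : ℕ} (lam : ℝ) (μ : Fin J → ℕ → ℝ)
    (r : Finset (Fin J) → Option (Fin J) → Option (Fin J) → ℝ)
    (hrsto : ∀ D : Finset (Fin J), ∀ i ∈ ext J D, ∑ j ∈ ext J D, r D i j = 1)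
    (A B : Finset (Fin J) → ℝ) (g : Est J → ℝ) (x : Est J) :
    QZ lam μ r A B g x =
      (∑ j ∈ ext J x.1, ∑ i ∈ ext J x.1, r x.1 j i *
        (rt lam μ j x.2 * g (x.1, x.2 - eV j + eV i)))
      - (∑ j ∈ ext J x.1, rt lam μ j x.2) * g x
      + ((∑ H ∈ Finset.univ.filter (fun H => H ⊂ x.1), B x.1 / B H * (g (H, x.2) - g x))
    + ∑ I ∈ Finset.univ.filter (fun I => x.1 ⊂ I), A I / A x.1 * (g (I, x.2) - g x)) := by
  have hs : ∀ F : Option (Fin J) → ℝ, ∑ j ∈ ext J x.1, F j = F none + ∑ j ∈ x.1ᶜ, F (some j) := by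
    intro F
    unfold ext
    rw [Finset.sum_insert (by simp), Finset.sum_image (by intro a _ b _ h; simpa using h)]
  have key : (∑ j ∈ ext J x.1, ∑ i ∈ ext J x.1, r x.1 j i *
        (rt lam μ j x.2 * g (x.1, x.2 - eV j + eV i)))
      - (∑ j ∈ ext J x.1, rt lam μ j x.2) * g x
      = ∑ j ∈ ext J x.1, ∑ i ∈ ext J x.1, rt lam μ j x.2 * r x.1 j i *
        (g (x.1, x.2 - eV j + eV i) - g x) := by
    rw [Finset.sum_mul, ← Finset.sum_sub_distrib]
    refine Finset.sum_congr rfl fun j hj => ?_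
    have : rt lam μ j x.2 * g x = ∑ i ∈ ext J x.1, r x.1 j i * (rt lam μ j x.2 * g x) := by
      rw [← Finset.sum_mul, hrsto _ _ hj, one_mul]
    rw [this, ← Finset.sum_sub_distrib]
    exact Finset.sum_congr rfl fun i _ => by ring
  rw [key, hs]
  simp only [hs, Finset.sum_add_distrib]
  unfold QZ
  simp only [rt, eV_none, tsub_zero, add_zero, sub_self, mul_zero, zero_add]
  ring

lemma sum_cR {J : ℕ} (r : Finset (Fin J) → Option (Fin J) → Option (Fin J) → ℝ)
    (D : Finset (Fin J)) (G : Option (Fin J) → Option (Fin J) → ℝ) :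
    ∑ j ∈ ext J D, ∑ i ∈ ext J D, r D j i * G j i = ∑ j, ∑ i, cR r D j i * G j i := by
  unfold cR
  simp only [ite_mul, zero_mul]
  have : ∀ j, (∑ i, if j ∈ ext J D then (if i ∈ ext J D then r D j i * G j i else 0) else 0)
      = if j ∈ ext J D then ∑ i ∈ ext J D, r D j i * G j i else 0 := by
    intro j
    split_ifs
    · rw [Finset.sum_ite_mem, Finset.univ_inter]
    · simp
  simp only [this]
  rw [Finset.sum_ite_mem, Finset.univ_inter]

set_option maxHeartbeats 2000000 in
/-- change of routing.  Difference of one-step correlations of two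
networks sharing everything except the (re)routing, together with the trace
representation of the inner double sum. -/
theorem correlation_difference_routing
    (J : ℕ) (hJ : 1 ≤ J)
    (lam : ℝ) (hlam : 0 < lam)
    (μ : Fin J → ℕ → ℝ)
    (hμ0 : ∀ j, μ j 0 = 0)
    (hμpos : ∀ j k, k ≠ 0 → 0 < μ j k)
    (hμbdd : ∃ M : ℝ, ∀ j k, μ j k ≤ M)
    (r : Finset (Fin J) → Option (Fin J) → Option (Fin J) → ℝ)
    (hrnn : ∀ D : Finset (Fin J), ∀ i ∈ ext J D, ∀ j ∈ ext J D, 0 ≤ r D i j)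
    (hrsto : ∀ D : Finset (Fin J), ∀ i ∈ ext J D, ∑ j ∈ ext J D, r D i j = 1)
    (η : Fin J → ℝ) (hη : ∀ j, 0 < η j)
    (htraffic : ∀ D : Finset (Fin J), ∀ j ∈ Dᶜ,
      η j = lam * r D none (some j) + ∑ i ∈ Dᶜ, η i * r D (some i) (some j))
    (r' : Finset (Fin J) → Option (Fin J) → Option (Fin J) → ℝ)
    (hrnn' : ∀ D : Finset (Fin J), ∀ i ∈ ext J D, ∀ j ∈ ext J D, 0 ≤ r' D i j)
    (hrsto' : ∀ D : Finset (Fin J), ∀ i ∈ ext J D, ∑ j ∈ ext J D, r' D i j = 1)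
    (htraffic' : ∀ D : Finset (Fin J), ∀ j ∈ Dᶜ,
      η j = lam * r' D none (some j) + ∑ i ∈ Dᶜ, η i * r' D (some i) (some j))
    (A B : Finset (Fin J) → ℝ)
    (hApos : ∀ D, 0 < A D) (hBpos : ∀ D, 0 < B D)
    (hA0 : A (∅ : Finset (Fin J)) = 1) (hB0 : B (∅ : Finset (Fin J)) = 1)
    (hC : ∀ j, Summable (fun k => prodK η μ j k))
    (f g : Est J → ℝ)
    (hf : Summable (fun x : Est J => f x * f x * piZ η μ A B x))
    (hg : Summable (fun x : Est J => g x * g x * piZ η μ A B x)) :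
    ((∑' x : Est J, f x * QZ lam μ r A B g x * piZ η μ A B x)
        - ∑' x : Est J, f x * QZ lam μ r' A B g x * piZ η μ A B x)
      = (∑' x : Est J, piZ η μ A B x * (lam / xiV lam η x.1 none) *
          ∑ j ∈ ext J x.1, ∑ i ∈ ext J x.1,
            xiV lam η x.1 j * (r x.1 j i - r' x.1 j i)
              * f (x.1, x.2 + eV j) * g (x.1, x.2 + eV i))
      ∧ ∀ (D : Finset (Fin J)) (n : Fin J → ℕ),
          (∑ j ∈ ext J D, ∑ i ∈ ext J D,
              xiV lam η D j * (r D j i - r' D j i)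
                * f (D, n + eV j) * g (D, n + eV i))
            = ∑ k ∈ ext J D, ∑ j ∈ ext J D,
                (g (D, n + eV k) * f (D, n + eV j))
                  * (xiV lam η D j * (r D j k - r' D j k)) := by
  have hp := piZ_nn η hη μ hμpos A B hApos hBpos
  have hU : ∀ j i, Summable (Uu lam η μ A B f g j i) := fun j i =>
    (summ_cs hp (summ_shift lam hlam μ hμ0 hμpos hμbdd η hη A B f hf j)
      (summ_shift lam hlam μ hμ0 hμpos hμbdd η hη A B g hg i)).mul_left _
  have hsupp : ∀ (c : Finset (Fin J) → ℝ) j i,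
      Function.support (fun x : Est J => c x.1 * Tt lam η μ A B f g j i x) ⊆ Set.range (sh j) := by
    intro c j i x hx
    by_contra h
    exact hx (by simp [Tt, rt_zero lam μ hμ0 j x h])
  have hcomp : ∀ (c : Finset (Fin J) → ℝ) j i,
      (fun x : Est J => c x.1 * Tt lam η μ A B f g j i x) ∘ sh j
        = fun x : Est J => c x.1 * Uu lam η μ A B f g j i x := by
    intro c j i
    funext x
    simp only [Function.comp, T_sh lam η μ hμpos]
    rfl
  have hcU : ∀ (c : Finset (Fin J) → ℝ) j i,
      Summable (fun x : Est J => c x.1 * Uu lam η μ A B f g j i x) :=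
    fun c j i => summ_fin c (hU j i)
  have hcT : ∀ (c : Finset (Fin J) → ℝ) j i,
      Summable (fun x : Est J => c x.1 * Tt lam η μ A B f g j i x) := by
    intro c j i
    rw [← (sh_inj j).summable_iff (fun x hx => Function.notMem_support.mp
      (fun h => hx (hsupp c j i h))), hcomp]
    exact hcU c j i
  have hTU : ∀ (c : Finset (Fin J) → ℝ) j i,
      ∑' x : Est J, c x.1 * Tt lam η μ A B f g j i x
        = ∑' x : Est J, c x.1 * Uu lam η μ A B f g j i x := by
    intro c j i
    rw [← (sh_inj j).tsum_eq (hsupp c j i)]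
    exact congrArg tsum (hcomp c j i)
  have hfg := summ_cs hp hf hg
  -- breakdown part
  have hgH : ∀ H, Summable (fun x : Est J => f x * g (H, x.2) * piZ η μ A B x) := by
    intro H
    refine summ_cs hp hf (v := fun x => g (H, x.2)) ?_
    have h1 : Summable fun n : Fin J → ℕ => g (H, n) * g (H, n) * piX η μ n := by
      have h2 := hg.comp_injective (i := fun n : Fin J → ℕ => ((H, n) : Est J))
        (fun a b h => (Prod.ext_iff.mp h).2)
      refine (h2.mul_left (piY A B H)⁻¹).congr fun n => ?_
      have := (piY_pos A B hApos hBpos H).ne'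
      simp only [Function.comp, piZ]
      field_simp
    have h3 := Summable.mul_of_nonneg (f := piY A B) (Summable.of_finite) h1
      (fun D => (piY_pos A B hApos hBpos D).le)
      (fun n => mul_nonneg (mul_self_nonneg _) (piX_nn η hη μ hμpos n))
    exact h3.congr fun x => by simp only [piZ]; ring
  have hBr : Summable fun x : Est J => f x *
      ((∑ H ∈ Finset.univ.filter (fun H => H ⊂ x.1), B x.1 / B H * (g (H, x.2) - g x))
    + ∑ I ∈ Finset.univ.filter (fun I => x.1 ⊂ I), A I / A x.1 * (g (I, x.2) - g x))
      * piZ η μ A B x := by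
    have h1 : Summable fun x : Est J => ∑ H, 
        ((if H ⊂ x.1 then B x.1 / B H else 0) + (if x.1 ⊂ H then A H / A x.1 else 0)) *
          (f x * g (H, x.2) * piZ η μ A B x - f x * g x * piZ η μ A B x) :=
      summable_sum fun H _ => summ_fin (fun D => 
        ((if H ⊂ D then B D / B H else 0) + (if D ⊂ H then A H / A D else 0)))
        ((hgH H).sub hfg)
    refine h1.congr fun x => ?_
    rw [Finset.sum_filter, Finset.sum_filter, ← Finset.sum_add_distrib, Finset.mul_sum,
      Finset.sum_mul]
    refine Finset.sum_congr rfl fun H _ => ?_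
    split_ifs <;> ring
  have hDi : Summable fun x : Est J =>
      (∑ j ∈ ext J x.1, rt lam μ j x.2) * (f x * g x * piZ η μ A B x) := by
    obtain ⟨K, hK⟩ := rt_bdd lam hlam μ hμ0 hμpos hμbdd
    have hK0 : 0 ≤ K := (abs_nonneg _).trans (hK none 0)
    refine summ_bdd hfg (∑ j : Option (Fin J), K) fun x => ?_
    refine (Finset.abs_sum_le_sum_abs _ _).trans ((Finset.sum_le_sum fun j _ => hK j x.2).trans ?_)
    exact Finset.sum_le_sum_of_subset_of_nonneg (Finset.subset_univ _) fun _ _ _ => hK0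
  have hS : ∀ ρ : Finset (Fin J) → Option (Fin J) → Option (Fin J) → ℝ,
      Summable fun x : Est J => ∑ j, ∑ i, cR ρ x.1 j i * Tt lam η μ A B f g j i x := fun ρ =>
    summable_sum fun j _ => summable_sum fun i _ => hcT (fun D => cR ρ D j i) j i
  have hSU : ∀ ρ : Finset (Fin J) → Option (Fin J) → Option (Fin J) → ℝ,
      Summable fun x : Est J => ∑ j, ∑ i, cR ρ x.1 j i * Uu lam η μ A B f g j i x := fun ρ =>
    summable_sum fun j _ => summable_sum fun i _ => hcU (fun D => cR ρ D j i) j i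
  have hSeq : ∀ ρ : Finset (Fin J) → Option (Fin J) → Option (Fin J) → ℝ,
      ∑' x : Est J, ∑ j, ∑ i, cR ρ x.1 j i * Tt lam η μ A B f g j i x
      = ∑' x : Est J, ∑ j, ∑ i, cR ρ x.1 j i * Uu lam η μ A B f g j i x := by
    intro ρ
    rw [Summable.tsum_finsetSum (fun j _ => summable_sum fun i _ => hcT (fun D => cR ρ D j i) j i),
      Summable.tsum_finsetSum (fun j _ => summable_sum fun i _ => hcU (fun D => cR ρ D j i) j i)]
    refine Finset.sum_congr rfl fun j _ => ?_
    rw [Summable.tsum_finsetSum (fun i _ => hcT (fun D => cR ρ D j i) j i),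
      Summable.tsum_finsetSum (fun i _ => hcU (fun D => cR ρ D j i) j i)]
    exact Finset.sum_congr rfl fun i _ => hTU (fun D => cR ρ D j i) j i
  have hP := hBr.sub hDi
  have hmain : ∀ ρ : Finset (Fin J) → Option (Fin J) → Option (Fin J) → ℝ,
      (∀ D : Finset (Fin J), ∀ i ∈ ext J D, ∑ j ∈ ext J D, ρ D i j = 1) →
      ∑' x : Est J, f x * QZ lam μ ρ A B g x * piZ η μ A B x
        = (∑' x : Est J, ∑ j, ∑ i, cR ρ x.1 j i * Uu lam η μ A B f g j i x) + tsum (fun x : Est J =>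
      f x * ((∑ H ∈ Finset.univ.filter (fun H => H ⊂ x.1), B x.1 / B H * (g (H, x.2) - g x))
    + ∑ I ∈ Finset.univ.filter (fun I => x.1 ⊂ I), A I / A x.1 * (g (I, x.2) - g x))
      * piZ η μ A B x - (∑ j ∈ ext J x.1, rt lam μ j x.2) * (f x * g x * piZ η μ A B x)) := by
    intro ρ hρ
    rw [← hSeq, ← (hS ρ).tsum_add hP]
    refine tsum_congr fun x => ?_
    rw [QZ_decomp lam μ ρ hρ, ← sum_cR]
    have : ∑ j ∈ ext J x.1, ∑ i ∈ ext J x.1, ρ x.1 j i * Tt lam η μ A B f g j i x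
        = f x * (∑ j ∈ ext J x.1, ∑ i ∈ ext J x.1, ρ x.1 j i *
        (rt lam μ j x.2 * g (x.1, x.2 - eV j + eV i))) * piZ η μ A B x := by
      simp only [Finset.mul_sum, Finset.sum_mul]
      refine Finset.sum_congr rfl fun j _ => Finset.sum_congr rfl fun i _ => ?_
      unfold Tt
      ring
    rw [this]
    ring
  refine ⟨?_, ?_⟩
  · rw [hmain r hrsto, hmain r' hrsto', add_sub_add_right_eq_sub, ← (hSU r).tsum_sub (hSU r')]
    refine tsum_congr fun x => ?_
    rw [← sum_cR, ← sum_cR, ← Finset.sum_sub_distrib, Finset.mul_sum]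
    refine Finset.sum_congr rfl fun j _ => ?_
    rw [← Finset.sum_sub_distrib, Finset.mul_sum]
    refine Finset.sum_congr rfl fun i _ => ?_
    have hSpos : 0 < ∑ k ∈ ext J x.1, etaE lam η k :=
      Finset.sum_pos (fun k _ => etaE_pos lam hlam η hη k) ⟨none, by simp [ext]⟩
    have hx : lam / xiV lam η x.1 none * xiV lam η x.1 j = etaE lam η j := by
      have h0 : etaE lam η none = lam := rfl
      unfold xiV
      rw [h0]
      have := hlam.ne'
      have := hSpos.ne'
      field_simp
    unfold Uu
    rw [← hx]
    simp only [sh]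
    ring
  · intro D n
    rw [Finset.sum_comm]
    refine Finset.sum_congr rfl fun j _ => Finset.sum_congr rfl fun i _ => ?_
    ring

end UnrelNet
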